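/- Let n ≥ 1 and let C = ((i_0, j_0), …, (i_{q−1}, j_{q−1})), with i_l < j_l, be a sorting network for ℝⁿ. Define the polytope Q_n ⊆ (ℝⁿ)^{q+1} as the set of tuples (y_0, y_1, …, y_q) such that: y_q = (1, 2, …, n); and for every 0 ≤ l ≤ q−1: (y_{l+1})_m = (y_l)_m for all m ∉ {i_l, j_l}, (y_{l+1})_{i_l} + (y_{l+1})_{j_l} = (y_l)_{i_l} + (y_l)_{j_l}, and (y_{l+1})_{j_l} − (y_{l+1})_{i_l} ≥ |(y_l)_{j_l} − (y_l)_{i_l}|. Then the image of Q_n under the projection (y_0, …, y_q) ↦ y_0 equals the permutahedron Perm(n), i.e. the convex hull of the vectors x_σ = (σ(1), …, σ(n)) over all permutations σ of [n]. -/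

import Mathlib

noncomputable section

/-- Conditional reflection `σ⁺_{i,j}`: replaces `(x i, x j)` by `(min, max)`. -/
def sigP {n : ℕ} (i j : Fin n) (x : Fin n → ℝ) : Fin n → ℝ :=
  fun k => if k = i then min (x i) (x j) else if k = j then max (x i) (x j) else x k

/-- `σ⁺_C = σ⁺_{i_{q-1},j_{q-1}} ∘ ⋯ ∘ σ⁺_{i_0,j_0}`. -/
def netP {n : ℕ} (C : List (Fin n × Fin n)) (x : Fin n → ℝ) : Fin n → ℝ :=
  C.foldl (fun y p => sigP p.1 p.2 y) x

/-- The vector `x_σ = (σ(1), …, σ(n))`. -/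
def permVec {n : ℕ} (σ : Equiv.Perm (Fin n)) : Fin n → ℝ :=
  fun k => ((σ k : ℕ) : ℝ) + 1

/-- The set of the vectors `x_σ` is stable under permuting coordinates, hence so is its hull. -/
lemma comp_mem_convexHull_permVec {n : ℕ} (τ : Equiv.Perm (Fin n)) {v : Fin n → ℝ}
    (hv : v ∈ convexHull ℝ {x : Fin n → ℝ | ∃ σ : Equiv.Perm (Fin n), x = permVec σ}) :
    v ∘ τ ∈ convexHull ℝ {x : Fin n → ℝ | ∃ σ : Equiv.Perm (Fin n), x = permVec σ} := by
  have hsub : convexHull ℝ {x : Fin n → ℝ | ∃ σ : Equiv.Perm (Fin n), x = permVec σ} ⊆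
      LinearMap.funLeft ℝ ℝ τ ⁻¹'
        convexHull ℝ {x : Fin n → ℝ | ∃ σ : Equiv.Perm (Fin n), x = permVec σ} := by
    refine convexHull_min ?_ ((convex_convexHull ℝ _).linear_preimage _)
    rintro _ ⟨σ, rfl⟩
    exact subset_convexHull ℝ _ ⟨σ * τ, rfl⟩
  exact hsub hv

/-- A vector `y` satisfying the comparator inequalities with respect to `z` lies on the segment
between `z` and its image under the transposition of `i` and `j`. -/
lemma exists_convex_combination_swap {n : ℕ} {i j : Fin n} (hij : i ≠ j) {y z : Fin n → ℝ}
    (hfix : ∀ m, m ≠ i → m ≠ j → z m = y m) (hsum : z i + z j = y i + y j)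
    (habs : |y j - y i| ≤ z j - z i) :
    ∃ a b : ℝ, 0 ≤ a ∧ 0 ≤ b ∧ a + b = 1 ∧ a • z + b • (z ∘ Equiv.swap i j) = y := by
  obtain ⟨h₁, h₂⟩ := abs_le.mp habs
  obtain ⟨a, ha₀, ha₁, ha⟩ : ∃ a : ℝ, 0 ≤ a ∧ a ≤ 1 ∧
      (2 * a - 1) * (z j - z i) = y j - y i := by
    rcases (abs_nonneg _ |>.trans habs).eq_or_lt with h | h
    · exact ⟨1, by norm_num, le_rfl, by linarith⟩
    · refine ⟨((y j - y i) + (z j - z i)) / (2 * (z j - z i)), ?_, ?_, ?_⟩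
      · exact div_nonneg (by linarith) (by linarith)
      · rw [div_le_one (by linarith)]; linarith
      · field_simp
        ring
  refine ⟨a, 1 - a, ha₀, by linarith, by ring, ?_⟩
  ext m
  simp only [Pi.add_apply, Pi.smul_apply, Function.comp_apply, smul_eq_mul]
  by_cases hi : m = i
  · subst hi
    rw [Equiv.swap_apply_left]
    linarith
  by_cases hj : m = j
  · subst hj
    rw [Equiv.swap_apply_right]
    linarith
  · rw [Equiv.swap_apply_of_ne_of_ne hi hj, hfix m hi hj]
    ring

lemma permVec_eq_of_monotone {n : ℕ} {σ : Equiv.Perm (Fin n)} (h : Monotone (permVec σ)) :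
    permVec σ = fun k : Fin n => ((k : ℕ) : ℝ) + 1 := by
  have hmono : Monotone σ := fun a b hab => by simpa [permVec] using h hab
  have hσ : (σ : Fin n → Fin n) = id :=
    ((hmono.strictMono_of_injective σ.injective).range_inj strictMono_id).mp (by simp)
  ext k
  simp [permVec, hσ]

lemma netP_take_succ {n : ℕ} (C : List (Fin n × Fin n)) (x : Fin n → ℝ) (l : Fin C.length) :
    netP (C.take (l + 1)) x = sigP (C.get l).1 (C.get l).2 (netP (C.take l) x) := by
  rw [netP, ← List.take_append_getElem l.isLt, List.foldl_append]
  rfl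

/-- Goemans' extension: the projection of the polytope `Q_n` (built from a
sorting network `C` in `q` comparators) onto the first block of coordinates
is the permutahedron `Perm(n)`. -/
theorem stmt11 (n : ℕ) (hn : 1 ≤ n) (C : List (Fin n × Fin n))
    (hC : ∀ p ∈ C, p.1 < p.2)
    (hsort : ∀ x : Fin n → ℝ, Monotone (netP C x) ∧
      ∃ π : Equiv.Perm (Fin n), netP C x = x ∘ π) :
    {v : Fin n → ℝ | ∃ y : Fin (C.length + 1) → Fin n → ℝ,
        (y (Fin.last C.length) = fun k : Fin n => ((k : ℕ) : ℝ) + 1) ∧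
        (∀ l : Fin C.length,
          (∀ m : Fin n, m ≠ (C.get l).1 → m ≠ (C.get l).2 →
            y l.succ m = y l.castSucc m) ∧
          (y l.succ (C.get l).1 + y l.succ (C.get l).2
            = y l.castSucc (C.get l).1 + y l.castSucc (C.get l).2) ∧
          |y l.castSucc (C.get l).2 - y l.castSucc (C.get l).1|
            ≤ y l.succ (C.get l).2 - y l.succ (C.get l).1) ∧
        v = y 0}
      = convexHull ℝ {x : Fin n → ℝ | ∃ σ : Equiv.Perm (Fin n), x = permVec σ} := by
  apply Set.Subset.antisymm
  · rintro _ ⟨y, hlast, hstep, rfl⟩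
    suffices h : ∀ l, y l ∈ convexHull ℝ
        {x : Fin n → ℝ | ∃ σ : Equiv.Perm (Fin n), x = permVec σ} from h 0
    intro l
    induction l using Fin.reverseInduction with
    | last => exact subset_convexHull ℝ _ ⟨1, hlast⟩
    | cast l ih =>
      obtain ⟨hfix, hsum, habs⟩ := hstep l
      obtain ⟨a, b, ha, hb, hab, h⟩ :=
        exists_convex_combination_swap (hC _ (C.get_mem l)).ne hfix hsum habs
      rw [← h]
      exact convex_convexHull ℝ _ ih (comp_mem_convexHull_permVec _ ih) ha hb hab
  · refine convexHull_min ?_ ?_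
    · rintro _ ⟨σ, rfl⟩
      refine ⟨fun l => netP (C.take l) (permVec σ), ?_, fun l => ?_, by simp [netP]⟩
      · obtain ⟨hmono, π, hπ⟩ := hsort (permVec σ)
        have hperm : netP C (permVec σ) = permVec (σ * π) := hπ
        rw [hperm] at hmono
        simpa [hperm] using permVec_eq_of_monotone hmono
      · have hne : (C.get l).2 ≠ (C.get l).1 := (hC _ (C.get_mem l)).ne'
        simp only [Fin.val_succ, Fin.val_castSucc, netP_take_succ]
        refine ⟨fun m hi hj => by rw [sigP, if_neg hi, if_neg hj], ?_, ?_⟩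
        · simp only [sigP, if_pos, if_neg hne]
          exact min_add_max _ _
        · simp only [sigP, if_pos, if_neg hne]
          rw [max_sub_min_eq_abs]
    · rintro _ ⟨y, hlast, hstep, rfl⟩ _ ⟨y', hlast', hstep', rfl⟩ a b ha hb hab
      refine ⟨a • y + b • y', ?_, fun l => ?_, rfl⟩
      · ext k
        simp only [Pi.add_apply, Pi.smul_apply, hlast, hlast', smul_eq_mul]
        rw [← add_mul, hab, one_mul]
      · obtain ⟨hfix, hsum, habs⟩ := hstep l
        obtain ⟨hfix', hsum', habs'⟩ := hstep' l
        simp only [Pi.add_apply, Pi.smul_apply, smul_eq_mul]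
        refine ⟨fun m hi hj => by rw [hfix m hi hj, hfix' m hi hj], ?_, ?_⟩
        · linear_combination a * hsum + b * hsum'
        · obtain ⟨h₁, h₂⟩ := abs_le.mp habs
          obtain ⟨h₁', h₂'⟩ := abs_le.mp habs'
          rw [abs_le]
          constructor
          · linarith [mul_le_mul_of_nonneg_left h₁ ha, mul_le_mul_of_nonneg_left h₁' hb]
          · linarith [mul_le_mul_of_nonneg_left h₂ ha, mul_le_mul_of_nonneg_left h₂' hb]
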